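/- Suppose Assumption 2 holds, and let λ ∈ (0,1) and q ∈ B_op(λR₂). Then the ODE ẋ_q(t) = f_q(x_q(t)) with x_q(0) = q has a unique solution x_q on [0, τ̃_min(λ)], and this solution satisfies x_q(t) ∈ B_op(R₂) for all t ∈ [0, τ̃_min(λ)]. -/

import Mathlib

set_option autoImplicit false

open Filter Set MeasureTheory Real
open scoped Topology ENNReal

noncomputable section

/-- `N` is a norm on `ℝ^n`. -/
structure IsVecNorm {n : ℕ} (N : (Fin n → ℝ) → ℝ) : Prop where
  eq_zero : ∀ x, N x = 0 ↔ x = 0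
  smul_eq : ∀ (a : ℝ) (x : Fin n → ℝ), N (a • x) = |a| * N x
  add_le : ∀ x y : Fin n → ℝ, N (x + y) ≤ N x + N y

/-- The matrix norm induced by the vector norm `N`. -/
def matNorm {n : ℕ} (N : (Fin n → ℝ) → ℝ) (A : Matrix (Fin n) (Fin n) ℝ) : ℝ :=
  sSup {c : ℝ | ∃ x : Fin n → ℝ, N x = 1 ∧ c = N (A.mulVec x)}

/-- The logarithmic norm `μ_N(A) = lim_{ε→0⁺} (‖I+εA‖_N − 1)/ε`. -/
def logNorm {n : ℕ} (N : (Fin n → ℝ) → ℝ) (A : Matrix (Fin n) (Fin n) ℝ) : ℝ :=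
  limUnder (𝓝[>] (0 : ℝ)) (fun ε : ℝ => (matNorm N (1 + ε • A) - 1) / ε)

/-- The Jacobian matrix of `F` at `x`. -/
def jacobian {n : ℕ} (F : (Fin n → ℝ) → (Fin n → ℝ)) (x : Fin n → ℝ) :
    Matrix (Fin n) (Fin n) ℝ :=
  Matrix.of fun i j => fderiv ℝ F x (Pi.single j 1) i

/-- Open ball of radius `r` centered at `0` w.r.t. the norm `N`. -/
def nball {n : ℕ} (N : (Fin n → ℝ) → ℝ) (r : ℝ) : Set (Fin n → ℝ) := {x | N x < r}

/-- `ν(t) = d₂ ∫₀ᵗ e^{d₁ s} ds`. -/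
def nu (d₁ d₂ t : ℝ) : ℝ := d₂ * ∫ s in (0:ℝ)..t, Real.exp (d₁ * s)

/-- Diagonally-weighted r-norm `‖x‖_{r,[θ]} = ‖[θ]x‖_r`. -/
def wnorm {n : ℕ} (r : ℝ≥0∞) (θ x : Fin n → ℝ) : ℝ :=
  ‖(WithLp.equiv r (∀ _ : Fin n, ℝ)).symm (fun i => θ i * x i)‖

namespace IsVecNorm

variable {n : ℕ} {N : (Fin n → ℝ) → ℝ}

theorem zero (h : IsVecNorm N) : N 0 = 0 := (h.eq_zero 0).2 rfl

theorem neg (h : IsVecNorm N) (x : Fin n → ℝ) : N (-x) = N x := by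
  have := h.smul_eq (-1) x
  simpa using this

theorem nonneg (h : IsVecNorm N) (x : Fin n → ℝ) : 0 ≤ N x := by
  have h1 := h.add_le x (-x)
  rw [add_neg_cancel, h.zero, h.neg] at h1
  linarith

theorem sub_le (h : IsVecNorm N) (x y : Fin n → ℝ) : N x - N y ≤ N (x - y) := by
  have h1 := h.add_le (x - y) y
  rw [sub_add_cancel] at h1
  linarith

theorem sum_le (h : IsVecNorm N) {ι : Type*} (s : Finset ι) (v : ι → Fin n → ℝ) :
    N (∑ i ∈ s, v i) ≤ ∑ i ∈ s, N (v i) := by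
  classical
  induction s using Finset.induction_on with
  | empty => simp [h.zero]
  | insert a s ha ih =>
    rw [Finset.sum_insert ha, Finset.sum_insert ha]
    linarith [h.add_le (v a) (∑ i ∈ s, v i)]

theorem le_mul_norm (h : IsVecNorm N) (x : Fin n → ℝ) :
    N x ≤ (∑ i, N (Pi.single i 1)) * ‖x‖ := by
  have hx : x = ∑ i, x i • (Pi.single i 1 : Fin n → ℝ) := pi_eq_sum_univ' x
  calc N x = N (∑ i, x i • (Pi.single i 1 : Fin n → ℝ)) := by rw [← hx]
    _ ≤ ∑ i, N (x i • (Pi.single i 1 : Fin n → ℝ)) := h.sum_le _ _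
    _ ≤ ∑ i, N (Pi.single i 1) * ‖x‖ := by
        refine Finset.sum_le_sum fun i _ => ?_
        rw [h.smul_eq, mul_comm]
        exact mul_le_mul_of_nonneg_left (norm_le_pi_norm x i) (h.nonneg _)
    _ = _ := by rw [Finset.sum_mul]

theorem continuous (h : IsVecNorm N) : Continuous N := by
  have hC : 0 ≤ ∑ i, N (Pi.single i 1 : Fin n → ℝ) := Finset.sum_nonneg fun i _ => h.nonneg _
  refine (LipschitzWith.of_dist_le_mul (K := ⟨_, hC⟩) fun x y => ?_).continuous
  rw [Real.dist_eq, dist_eq_norm]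
  refine le_trans ?_ (h.le_mul_norm (x - y))
  rw [abs_le]
  have h1 := h.sub_le x y
  have h2 := h.sub_le y x
  rw [← h.neg (y - x), neg_sub] at h2
  constructor <;> linarith

theorem exists_norm_le (h : IsVecNorm N) : ∃ C : ℝ, 0 < C ∧ ∀ x, C * ‖x‖ ≤ N x := by
  rcases (Metric.sphere (0 : Fin n → ℝ) 1).eq_empty_or_nonempty with he | hne
  · refine ⟨1, one_pos, fun x => ?_⟩
    by_cases hx : x = 0
    · simp [hx, h.zero]
    · exfalso
      have : (‖x‖⁻¹ • x) ∈ Metric.sphere (0 : Fin n → ℝ) 1 := by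
        simp [norm_smul, hx]
      rw [he] at this
      exact this
  · obtain ⟨z, hz, hmin⟩ := (isCompact_sphere (0 : Fin n → ℝ) 1).exists_isMinOn hne
      h.continuous.continuousOn
    have hz0 : z ≠ 0 := by
      rintro rfl
      simp at hz
    refine ⟨N z, lt_of_le_of_ne (h.nonneg z) (fun h0 => hz0 ((h.eq_zero z).1 h0.symm)), fun x => ?_⟩
    by_cases hx : x = 0
    · simp [hx, h.zero]
    · have hm : (‖x‖⁻¹ • x) ∈ Metric.sphere (0 : Fin n → ℝ) 1 := by
        simp [norm_smul, hx]
      have h1 : N z ≤ N (‖x‖⁻¹ • x) := hmin hm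
      have hp : 0 < ‖x‖ := norm_pos_iff.2 hx
      rw [h.smul_eq, abs_of_pos (inv_pos.2 hp)] at h1
      calc N z * ‖x‖ ≤ (‖x‖⁻¹ * N x) * ‖x‖ := by gcongr
        _ = N x := by field_simp

theorem isCompact_le (h : IsVecNorm N) (r : ℝ) : IsCompact {x | N x ≤ r} := by
  obtain ⟨C, hC, hCx⟩ := h.exists_norm_le
  refine Metric.isCompact_of_isClosed_isBounded (isClosed_le h.continuous continuous_const) ?_
  refine (Metric.isBounded_closedBall (x := (0 : Fin n → ℝ)) (r := r / C)).subset fun x hx => ?_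
  rw [mem_closedBall_zero_iff, le_div_iff₀ hC]
  have : N x ≤ r := hx
  linarith [hCx x]

theorem convex_le (h : IsVecNorm N) (r : ℝ) : Convex ℝ {x | N x ≤ r} := by
  intro x hx y hy a b ha hb hab
  have hx' : N x ≤ r := hx
  have hy' : N y ≤ r := hy
  show N (a • x + b • y) ≤ r
  calc N (a • x + b • y) ≤ N (a • x) + N (b • y) := h.add_le _ _
    _ = a * N x + b * N y := by rw [h.smul_eq, h.smul_eq, abs_of_nonneg ha, abs_of_nonneg hb]
    _ ≤ a * r + b * r := by gcongr
    _ = r := by rw [← add_mul, hab, one_mul]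

theorem isOpen_nball (h : IsVecNorm N) (r : ℝ) : IsOpen (nball N r) :=
  isOpen_lt h.continuous continuous_const

/-- Supporting functional. -/
theorem exists_support (h : IsVecNorm N) (v : Fin n → ℝ) :
    ∃ l : (Fin n → ℝ) →ₗ[ℝ] ℝ, l v = N v ∧ ∀ x, l x ≤ N x := by
  by_cases hv : v = 0
  · exact ⟨0, by simp [hv, h.zero], fun x => by simpa using h.nonneg x⟩
  · obtain ⟨l, hl, hle⟩ := exists_extension_of_le_sublinear
      (LinearPMap.mkSpanSingleton (σ := RingHom.id ℝ) v (N v) hv) N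
      (fun c hc x => by rw [h.smul_eq, abs_of_pos hc]) h.add_le (by
        rintro ⟨x, hx⟩
        obtain ⟨c, rfl⟩ := Submodule.mem_span_singleton.1 hx
        have := LinearPMap.mkSpanSingleton'_apply (σ := RingHom.id ℝ) v (N v)
          (fun c hc => (smul_eq_zero.1 hc).elim (fun h => by rw [h]; simp) fun h => absurd h hv) c hx
        refine (le_of_eq this).trans ?_
        rw [h.smul_eq]
        simpa using mul_le_mul_of_nonneg_right (le_abs_self c) (h.nonneg v))
    refine ⟨l, ?_, hle⟩
    have := hl ⟨v, (Submodule.mem_span_singleton_self v : v ∈ Submodule.span ℝ {v})⟩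
    rw [LinearPMap.mkSpanSingleton_apply] at this
    exact this

theorem matNorm_bdd (h : IsVecNorm N) (A : Matrix (Fin n) (Fin n) ℝ) :
    BddAbove {c : ℝ | ∃ x : Fin n → ℝ, N x = 1 ∧ c = N (A.mulVec x)} := by
  have hc : Continuous fun x : Fin n → ℝ => N (A.mulVec x) :=
    h.continuous.comp (by fun_prop)
  obtain ⟨M, hM⟩ := (h.isCompact_le 1).bddAbove_image hc.continuousOn
  refine ⟨M, ?_⟩
  rintro c ⟨x, hx, rfl⟩
  exact hM ⟨x, hx.le, rfl⟩

theorem mulVec_le (h : IsVecNorm N) (A : Matrix (Fin n) (Fin n) ℝ) (v : Fin n → ℝ) :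
    N (A.mulVec v) ≤ matNorm N A * N v := by
  by_cases hv : v = 0
  · simp [hv, h.zero]
  have hp : 0 < N v := lt_of_le_of_ne (h.nonneg v) (fun h0 => hv ((h.eq_zero v).1 h0.symm))
  have h1 : N (A.mulVec ((N v)⁻¹ • v)) ≤ matNorm N A := by
    refine le_csSup (h.matNorm_bdd A) ⟨_, ?_, rfl⟩
    rw [h.smul_eq, abs_of_pos (inv_pos.2 hp)]
    field_simp
  rw [Matrix.mulVec_smul, h.smul_eq, abs_of_pos (inv_pos.2 hp)] at h1
  rw [inv_mul_le_iff₀ hp] at h1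
  linarith

theorem exists_unit (h : IsVecNorm N) (hn : 0 < n) : ∃ x, N x = 1 := by
  have hv : (fun _ => 1 : Fin n → ℝ) ≠ 0 := fun h0 => by simpa using congrFun h0 ⟨0, hn⟩
  have hp : 0 < N (fun _ => 1 : Fin n → ℝ) :=
    lt_of_le_of_ne (h.nonneg _) (fun h0 => hv ((h.eq_zero _).1 h0.symm))
  refine ⟨(N (fun _ => 1 : Fin n → ℝ))⁻¹ • (fun _ => 1), ?_⟩
  rw [h.smul_eq, abs_of_pos (inv_pos.2 hp)]
  field_simp

theorem support_le_quot (h : IsVecNorm N) (A : Matrix (Fin n) (Fin n) ℝ) (v : Fin n → ℝ)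
    (l : (Fin n → ℝ) →ₗ[ℝ] ℝ) (hlv : l v = N v) (hl : ∀ x, l x ≤ N x) (ε : ℝ) (hε : 0 < ε) :
    l (A.mulVec v) ≤ (matNorm N (1 + ε • A) - 1) / ε * N v := by
  have h1 := (hl ((1 + ε • A).mulVec v)).trans (h.mulVec_le (1 + ε • A) v)
  rw [Matrix.add_mulVec, Matrix.one_mulVec, Matrix.smul_mulVec, map_add, map_smul, hlv,
    smul_eq_mul] at h1
  rw [div_mul_eq_mul_div, le_div_iff₀ hε]
  linarith

theorem quot_tendsto (h : IsVecNorm N) (hn : 0 < n) (A : Matrix (Fin n) (Fin n) ℝ) :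
    Tendsto (fun ε : ℝ => (matNorm N (1 + ε • A) - 1) / ε) (𝓝[>] (0 : ℝ)) (𝓝 (logNorm N A)) := by
  have hmono : MonotoneOn (fun ε : ℝ => (matNorm N (1 + ε • A) - 1) / ε) (Ioi 0) := by
    intro a ha b hb hab
    have ha' : 0 < a := ha
    have hb' : 0 < b := hb
    have key : matNorm N (1 + a • A) ≤ (1 - a / b) + a / b * matNorm N (1 + b • A) := by
      obtain ⟨x0, hx0⟩ := h.exists_unit hn
      refine csSup_le ⟨_, x0, hx0, rfl⟩ ?_
      rintro c ⟨x, hx, rfl⟩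
      have hab1 : a / b ≤ 1 := (div_le_one hb').2 hab
      have e : (1 + a • A).mulVec x = (1 - a / b) • x + (a / b) • (1 + b • A).mulVec x := by
        simp only [Matrix.add_mulVec, Matrix.one_mulVec, Matrix.smul_mulVec, smul_add, smul_smul,
          sub_smul, one_smul]
        rw [div_mul_cancel₀ _ hb'.ne']
        abel
      rw [e]
      refine (h.add_le _ _).trans ?_
      rw [h.smul_eq, h.smul_eq, abs_of_nonneg (by linarith), abs_of_nonneg (by positivity), hx]
      have := h.mulVec_le (1 + b • A) x
      rw [hx, mul_one] at this
      have := mul_le_mul_of_nonneg_left this (by positivity : 0 ≤ a / b)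
      linarith
    show (matNorm N (1 + a • A) - 1) / a ≤ (matNorm N (1 + b • A) - 1) / b
    rw [div_le_iff₀ ha']
    have e : (matNorm N (1 + b • A) - 1) / b * a = a / b * matNorm N (1 + b • A) - a / b := by
      ring
    rw [e]
    linarith
  have hbdd : BddBelow ((fun ε : ℝ => (matNorm N (1 + ε • A) - 1) / ε) '' Ioi 0) := by
    obtain ⟨x0, hx0⟩ := h.exists_unit hn
    obtain ⟨l, hlv, hl⟩ := h.exists_support x0
    refine ⟨l (A.mulVec x0), ?_⟩
    rintro _ ⟨ε, hε, rfl⟩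
    have := h.support_le_quot A x0 l hlv hl ε hε
    rwa [hx0, mul_one] at this
  exact tendsto_nhds_limUnder ⟨_, hmono.tendsto_nhdsGT hbdd⟩

theorem support_le_logNorm (h : IsVecNorm N) (hn : 0 < n) (A : Matrix (Fin n) (Fin n) ℝ)
    (v : Fin n → ℝ) (l : (Fin n → ℝ) →ₗ[ℝ] ℝ) (hlv : l v = N v) (hl : ∀ x, l x ≤ N x) :
    l (A.mulVec v) ≤ logNorm N A * N v := by
  refine ge_of_tendsto ((h.quot_tendsto hn A).mul_const (N v)) ?_
  filter_upwards [self_mem_nhdsWithin] with ε hε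
  exact h.support_le_quot A v l hlv hl ε hε

end IsVecNorm

theorem jacobian_mulVec {n : ℕ} (F : (Fin n → ℝ) → (Fin n → ℝ)) (x v : Fin n → ℝ) :
    (jacobian F x).mulVec v = fderiv ℝ F x v := by
  have hv : v = ∑ i, v i • (Pi.single i 1 : Fin n → ℝ) := pi_eq_sum_univ' v
  conv_rhs => rw [hv]
  ext i
  simp only [jacobian, Matrix.mulVec, dotProduct, Matrix.of_apply, map_sum, map_smul,
    Finset.sum_apply, Pi.smul_apply, smul_eq_mul]
  exact Finset.sum_congr rfl fun j _ => mul_comm _ _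

/-- One-sided Lipschitz estimate through a supporting functional. -/
theorem one_sided {n : ℕ} (hn : 0 < n) {N : (Fin n → ℝ) → ℝ} (h : IsVecNorm N)
    (F : (Fin n → ℝ) → (Fin n → ℝ)) (d₁ R ρ : ℝ) (hρ : ρ < R)
    (hC1 : ContDiffOn ℝ 1 F (nball N R))
    (hmu : ∀ x ∈ nball N R, logNorm N (jacobian F x) ≤ d₁)
    (q x : Fin n → ℝ) (hq : N q ≤ ρ) (hx : N x ≤ ρ)
    (l : (Fin n → ℝ) →ₗ[ℝ] ℝ) (hlv : l (x - q) = N (x - q)) (hl : ∀ y, l y ≤ N y) :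
    l (F x) ≤ d₁ * N (x - q) + l (F q) := by
  have hd : ∀ z ∈ {z | N z ≤ ρ}, HasFDerivWithinAt (fun y => l (F y))
      ((LinearMap.toContinuousLinearMap l).comp (fderiv ℝ F z)) {z | N z ≤ ρ} z := by
    intro z hz
    have hz' : z ∈ nball N R := lt_of_le_of_lt hz hρ
    have h1 : DifferentiableAt ℝ F z :=
      (hC1.differentiableOn (by norm_num)).differentiableAt ((h.isOpen_nball R).mem_nhds hz')
    exact ((LinearMap.toContinuousLinearMap l).hasFDerivAt.comp z h1.hasFDerivAt).hasFDerivWithinAt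
  obtain ⟨z, hz, he⟩ := domain_mvt hd (h.convex_le ρ) hq hx
  have hzm : N z ≤ ρ := (h.convex_le ρ).segment_subset hq hx hz
  have h2 := h.support_le_logNorm hn (jacobian F z) (x - q) l hlv hl
  rw [jacobian_mulVec] at h2
  have h3 := mul_le_mul_of_nonneg_right (hmu z (lt_of_le_of_lt hzm hρ)) (h.nonneg (x - q))
  have he' : l (F x) - l (F q) = l (fderiv ℝ F z (x - q)) := he
  linarith

/-- Barrier lemma. -/
theorem barrier {n : ℕ} (hn : 0 < n) {N : (Fin n → ℝ) → ℝ} (h : IsVecNorm N)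
    (F G : (Fin n → ℝ) → (Fin n → ℝ)) (d₁ R ρ : ℝ) (hρ : ρ < R)
    (hC1 : ContDiffOn ℝ 1 F (nball N R))
    (hmu : ∀ x ∈ nball N R, logNorm N (jacobian F x) ≤ d₁)
    (hG : ∀ x, N x ≤ ρ → G x = F x)
    (q : Fin n → ℝ) (c : ℝ) (hc : N (F q) < c) (B : ℝ → ℝ) (hB0 : 0 < B 0)
    (τ : ℝ) (hB : ∀ t, HasDerivAt B (d₁ * B t + c) t)
    (hBρ : ∀ t ∈ Icc 0 τ, N q + B t ≤ ρ)
    (y : ℝ → (Fin n → ℝ)) (hy0 : y 0 = q)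
    (hy : ∀ t ∈ Icc (0:ℝ) τ, HasDerivWithinAt y (G (y t)) (Icc 0 τ) t) :
    ∀ t ∈ Icc (0:ℝ) τ, N (y t) ≤ ρ := by
  have hyc : ContinuousOn y (Icc 0 τ) := fun t ht => (hy t ht).continuousWithinAt
  have hBc : Continuous B := continuous_iff_continuousAt.2 fun t => (hB t).continuousAt
  have huc : ContinuousOn (fun t => N (y t - q) - B t) (Icc 0 τ) :=
    (h.continuous.comp_continuousOn (hyc.sub continuousOn_const)).sub hBc.continuousOn
  have htri : ∀ t, N (y t) ≤ N q + N (y t - q) := fun t => by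
    linarith [h.sub_le (y t) q]
  have main : ∀ t ∈ Icc (0:ℝ) τ, N (y t - q) < B t := by
    by_contra! hcon
    obtain ⟨t1, ht1, hle1⟩ := hcon
    have hcl : IsCompact (Icc (0:ℝ) τ ∩ (fun t => N (y t - q) - B t) ⁻¹' Ici 0) :=
      isCompact_Icc.of_isClosed_subset (huc.preimage_isClosed_of_isClosed isClosed_Icc isClosed_Ici)
        inter_subset_left
    obtain ⟨t0, ⟨ht0, ht0'⟩, hmin⟩ := hcl.exists_isLeast ⟨t1, ht1, by simpa using hle1⟩
    have hge : B t0 ≤ N (y t0 - q) := by simpa using ht0'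
    have hpos : 0 < t0 := by
      rcases ht0.1.eq_or_lt with h0 | h0
      · rw [← h0, hy0, sub_self, h.zero] at hge
        linarith
      · exact h0
    have hlt : ∀ t ∈ Ico 0 t0, N (y t - q) < B t := by
      intro t ht
      by_contra! hc'
      have := hmin ⟨⟨ht.1, ht.2.le.trans ht0.2⟩, by simpa using hc'⟩
      linarith [ht.2]
    have hsub : Icc 0 t0 ⊆ Icc 0 τ := Icc_subset_Icc_right ht0.2
    have heq : N (y t0 - q) = B t0 := by
      refine le_antisymm ?_ hge
      have hcl0 : t0 ∈ closure (Ico 0 t0) := by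
        rw [closure_Ico hpos.ne]
        exact right_mem_Icc.2 hpos.le
      have hcw : ContinuousWithinAt (fun t => N (y t - q) - B t) (Ico 0 t0) t0 :=
        (huc t0 ht0).mono (Ico_subset_Icc_self.trans hsub)
      have := hcw.closure_le hcl0 continuousWithinAt_const
        (g := fun _ => (0:ℝ)) (fun t ht => by linarith [hlt t ht])
      linarith
    obtain ⟨l, hlv, hl⟩ := h.exists_support (y t0 - q)
    have hder : HasDerivWithinAt (fun t => l (y t - q) - B t)
        (l (G (y t0)) - (d₁ * B t0 + c)) (Icc 0 t0) t0 := by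
      have h1 : HasDerivWithinAt (fun t => y t - q) (G (y t0)) (Icc 0 t0) t0 :=
        ((hy t0 ht0).mono hsub).sub_const q
      have h2 := (LinearMap.toContinuousLinearMap l).hasFDerivAt.comp_hasDerivWithinAt t0 h1
      exact h2.sub (hB t0).hasDerivWithinAt
    have hmax : IsLocalMaxOn (fun t => l (y t - q) - B t) (Icc 0 t0) t0 := by
      refine IsMaxOn.localize fun t ht => ?_
      show l (y t - q) - B t ≤ l (y t0 - q) - B t0
      rw [hlv, heq, sub_self]
      rcases ht.2.eq_or_lt with h0 | h0
      · rw [h0, hlv, heq, sub_self]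
      · linarith [hl (y t - q), hlt t ⟨ht.1, h0⟩]
    have hcone : (0 - t0) ∈ posTangentConeAt (Icc 0 t0) t0 :=
      sub_mem_posTangentConeAt_of_segment_subset (by
        rw [segment_symm, segment_eq_Icc hpos.le])
    have hnp := hmax.hasFDerivWithinAt_nonpos hder.hasFDerivWithinAt hcone
    have hnp' : (0 - t0) * (l (G (y t0)) - (d₁ * B t0 + c)) ≤ 0 := by simpa using hnp
    have hyρ : N (y t0) ≤ ρ := by linarith [htri t0, hBρ t0 ht0]
    have hqρ : N q ≤ ρ := by
      have := hBρ t0 ht0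
      linarith [h.nonneg (y t0 - q)]
    have h3 := one_sided hn h F d₁ R ρ hρ hC1 hmu q (y t0) hqρ hyρ l hlv hl
    rw [← hG _ hyρ, heq] at h3
    have h4 := hl (F q)
    nlinarith
  intro t ht
  linarith [htri t, main t ht, hBρ t ht]

/-- A `C¹` field on the ball coincides on a smaller ball with a bounded Lipschitz field. -/
theorem exists_extension {n : ℕ} {N : (Fin n → ℝ) → ℝ} (h : IsVecNorm N)
    (F : (Fin n → ℝ) → (Fin n → ℝ)) (R ρ : ℝ) (hρ : ρ < R)
    (hC1 : ContDiffOn ℝ 1 F (nball N R)) :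
    ∃ (G : (Fin n → ℝ) → (Fin n → ℝ)) (K L : NNReal), LipschitzWith K G ∧ (∀ x, ‖G x‖ ≤ L) ∧
      ∀ x, N x ≤ ρ → G x = F x := by
  have hsub : {x | N x ≤ ρ} ⊆ nball N R := fun x hx => lt_of_le_of_lt hx hρ
  have hdc : ContinuousOn (fun x => ‖fderiv ℝ F x‖) {x | N x ≤ ρ} :=
    ((hC1.continuousOn_fderiv_of_isOpen (h.isOpen_nball R) le_rfl).mono hsub).norm
  obtain ⟨K0, hK0⟩ := (h.isCompact_le ρ).bddAbove_image hdc
  obtain ⟨M0, hM0⟩ := (h.isCompact_le ρ).bddAbove_image (hC1.continuousOn.mono hsub).norm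
  have hlip : LipschitzOnWith K0.toNNReal F {x | N x ≤ ρ} := by
    refine Convex.lipschitzOnWith_of_nnnorm_fderiv_le (𝕜 := ℝ) (fun x hx => ?_) (fun x hx => ?_)
      (h.convex_le ρ)
    · exact (hC1.differentiableOn (by norm_num)).differentiableAt
        ((h.isOpen_nball R).mem_nhds (hsub hx))
    · rw [← NNReal.coe_le_coe, coe_nnnorm]
      exact (hK0 ⟨x, hx, rfl⟩).trans (Real.le_coe_toNNReal K0)
  obtain ⟨g, hg, hge⟩ := hlip.extend_pi
  set M : ℝ := (M0.toNNReal : ℝ) with hM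
  have hMn : 0 ≤ M := NNReal.coe_nonneg _
  refine ⟨fun x i => max (-M) (min M (g x i)), K0.toNNReal, M0.toNNReal, ?_, ?_, ?_⟩
  · refine LipschitzWith.of_dist_le_mul fun x y => ?_
    refine (dist_pi_le_iff (by positivity)).2 fun i => ?_
    have hi : LipschitzWith K0.toNNReal fun x => g x i :=
      LipschitzWith.of_dist_le_mul fun x y => (dist_le_pi_dist _ _ i).trans (hg.dist_le_mul x y)
    exact ((hi.const_min M).const_max (-M)).dist_le_mul x y
  · intro x
    refine (pi_norm_le_iff_of_nonneg hMn).2 fun i => ?_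
    rw [Real.norm_eq_abs, abs_le]
    exact ⟨le_max_left _ _, max_le (by linarith) (min_le_left _ _)⟩
  · intro x hx
    funext i
    have h1 : ‖F x‖ ≤ M := (hM0 ⟨x, hx, rfl⟩).trans (Real.le_coe_toNNReal M0)
    have h2 : |F x i| ≤ M := (norm_le_pi_norm (F x) i).trans h1
    rw [abs_le] at h2
    show max (-M) (min M (g x i)) = F x i
    rw [← hge hx, min_eq_right h2.2, max_eq_right h2.1]

theorem stmt4
    {n m : ℕ} (hn : 0 < n) (hm : 0 < m)
    (f : (Fin n → ℝ) → (Fin m → ℝ) → (Fin n → ℝ)) (g : (Fin n → ℝ) → (Fin m → ℝ))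
    (hf : Continuous (fun p : (Fin n → ℝ) × (Fin m → ℝ) => f p.1 p.2)) (hg : Continuous g)
    (hf0 : f 0 (g 0) = 0)
    -- Assumption 2
    (Nop : (Fin n → ℝ) → ℝ) (hNop : IsVecNorm Nop) (d₁ d₂ R₂ : ℝ)
    (hd₁ : 0 ≤ d₁) (hd₂ : 0 < d₂) (hR₂ : 0 < R₂)
    (hC1 : ∀ q ∈ nball Nop R₂, ContDiffOn ℝ 1 (fun x => f x (g q)) (nball Nop R₂))
    (hmuop : ∀ q ∈ nball Nop R₂, ∀ x ∈ nball Nop R₂,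
      logNorm Nop (jacobian (fun y => f y (g q)) x) ≤ d₁)
    (hfqq : ∀ q ∈ nball Nop R₂, Nop (f q (g q)) ≤ d₂ * Nop q)
    (lam : ℝ) (hlam : 0 < lam ∧ lam < 1)
    (q : Fin n → ℝ) (hq : q ∈ nball Nop (lam * R₂))
    (τtmin : ℝ) (hτtmin : 0 < τtmin ∧ lam * (1 + nu d₁ d₂ τtmin) = 1) :
    ∃ xq : ℝ → (Fin n → ℝ),
      (xq 0 = q ∧ ∀ t ∈ Icc (0:ℝ) τtmin, HasDerivWithinAt xq (f (xq t) (g q)) (Icc 0 τtmin) t) ∧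
      (∀ y : ℝ → (Fin n → ℝ), y 0 = q →
        (∀ t ∈ Icc (0:ℝ) τtmin, HasDerivWithinAt y (f (y t) (g q)) (Icc 0 τtmin) t) →
        ∀ t ∈ Icc (0:ℝ) τtmin, y t = xq t) ∧
      (∀ t ∈ Icc (0:ℝ) τtmin, xq t ∈ nball Nop R₂) := by
  obtain ⟨hl0, hl1⟩ := hlam
  obtain ⟨hτ, hnu⟩ := hτtmin
  have hq' : Nop q < lam * R₂ := hq
  have hQ0 := hNop.nonneg q
  have hqR : q ∈ nball Nop R₂ := by
    show Nop q < R₂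
    nlinarith
  set J : ℝ → ℝ := fun t => ∫ s in (0:ℝ)..t, Real.exp (d₁ * s) with hJ
  have hcont : Continuous fun s : ℝ => Real.exp (d₁ * s) := by fun_prop
  have hJd : ∀ t, HasDerivAt J (Real.exp (d₁ * t)) t := fun t =>
    intervalIntegral.integral_hasDerivAt_right (hcont.intervalIntegrable _ _)
      (hcont.stronglyMeasurableAtFilter _ _) hcont.continuousAt
  have hJ0 : J 0 = 0 := by simp [hJ]
  have hdJ : ∀ t, d₁ * J t = Real.exp (d₁ * t) - 1 := by
    intro t
    have h1 : ∀ s ∈ uIcc 0 t, HasDerivAt (fun s => Real.exp (d₁ * s)) (d₁ * Real.exp (d₁ * s)) s := by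
      intro s _
      have := ((hasDerivAt_id s).const_mul d₁).exp
      simpa [mul_comm] using this
    have h2 := intervalIntegral.integral_eq_sub_of_hasDerivAt h1
      ((hcont.const_mul d₁).intervalIntegrable _ _)
    rw [intervalIntegral.integral_const_mul] at h2
    show d₁ * (∫ s in (0:ℝ)..t, Real.exp (d₁ * s)) = _
    rw [h2, mul_zero, Real.exp_zero]
  have hJmono : Monotone J := monotone_of_hasDerivAt_nonneg (fun t => hJd t) fun t => (Real.exp_pos _).le
  have hJτ : 0 ≤ J τtmin := hJ0 ▸ hJmono hτ.le
  have hnu' : lam * (1 + d₂ * J τtmin) = 1 := hnu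
  have hδ : 0 < R₂ - Nop q * (1 + d₂ * J τtmin) := by
    have h1 : 0 < 1 + d₂ * J τtmin := by positivity
    have := mul_lt_mul_of_pos_right hq' h1
    nlinarith
  set K : ℝ := 1 + (d₁ + 1) * J τtmin with hK
  have hKpos : 0 < K := by positivity
  set ε : ℝ := (R₂ - Nop q * (1 + d₂ * J τtmin)) / (2 * K) with hε
  have hεpos : 0 < ε := by positivity
  have hεK : ε * K < R₂ - Nop q * (1 + d₂ * J τtmin) := by
    have : ε * K = (R₂ - Nop q * (1 + d₂ * J τtmin)) / 2 := by
      rw [hε]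
      field_simp
    linarith
  set B : ℝ → ℝ := fun t => ε + (d₂ * Nop q + (d₁ + 1) * ε) * J t with hB
  have hBd : ∀ t, HasDerivAt B (d₁ * B t + (d₂ * Nop q + ε)) t := by
    intro t
    have h1 := ((hJd t).const_mul (d₂ * Nop q + (d₁ + 1) * ε)).const_add ε
    have hdt := hdJ t
    have e : d₁ * B t + (d₂ * Nop q + ε) =
        (d₂ * Nop q + (d₁ + 1) * ε) * Real.exp (d₁ * t) := by
      show d₁ * (ε + (d₂ * Nop q + (d₁ + 1) * ε) * J t) + (d₂ * Nop q + ε) = _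
      linear_combination (d₂ * Nop q + (d₁ + 1) * ε) * hdt
    rw [e]
    exact h1
  have hB0 : 0 < B 0 := by simp only [hB, hJ0]; linarith
  have hcoef : 0 ≤ d₂ * Nop q + (d₁ + 1) * ε := by positivity
  have hρ : Nop q + B τtmin < R₂ := by
    have : Nop q + B τtmin = Nop q * (1 + d₂ * J τtmin) + ε * K := by
      simp only [hB, hK]; ring
    linarith
  have hBρ : ∀ t ∈ Icc 0 τtmin, Nop q + B t ≤ Nop q + B τtmin := by
    intro t ht
    have := mul_le_mul_of_nonneg_left (hJmono ht.2) hcoef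
    simp only [hB]
    linarith
  have hc : Nop (f q (g q)) < d₂ * Nop q + ε := by linarith [hfqq q hqR]
  set F : (Fin n → ℝ) → (Fin n → ℝ) := fun x => f x (g q) with hF
  obtain ⟨G, KG, L, hGlip, hGb, hGF⟩ :=
    exists_extension hNop F R₂ (Nop q + B τtmin) hρ (hC1 q hqR)
  have hPL : IsPicardLindelof (fun _ : ℝ => G) (tmin := 0) (tmax := τtmin)
      ⟨0, left_mem_Icc.2 hτ.le⟩ q (L * τtmin.toNNReal) 0 L KG :=
    { lipschitzOnWith := fun t _ => hGlip.lipschitzOnWith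
      continuousOn := fun x _ => continuousOn_const
      norm_le := fun t _ x _ => hGb x
      mul_max_le := by simp [hτ.le] }
  obtain ⟨x, hx0, hx⟩ := hPL.exists_eq_forall_mem_Icc_hasDerivWithinAt₀
  have hx0' : x 0 = q := hx0
  have hxρ := barrier hn hNop F G d₁ R₂ (Nop q + B τtmin) hρ (hC1 q hqR) (hmuop q hqR) hGF q
    (d₂ * Nop q + ε) hc B hB0 τtmin hBd hBρ x hx0' hx
  have right : ∀ y : ℝ → (Fin n → ℝ),
      (∀ t ∈ Icc (0:ℝ) τtmin, HasDerivWithinAt y (G (y t)) (Icc 0 τtmin) t) →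
      ∀ t ∈ Ico (0:ℝ) τtmin, HasDerivWithinAt y (G (y t)) (Ici t) t := by
    intro y hy t ht
    refine (hy t ⟨ht.1, ht.2.le⟩).mono_of_mem_nhdsWithin ?_
    exact mem_of_superset (Icc_mem_nhdsGE ht.2) (Icc_subset_Icc_left ht.1)
  refine ⟨x, ⟨hx0', fun t ht => ?_⟩, fun y hy0 hy => ?_, fun t ht => lt_of_le_of_lt (hxρ t ht) hρ⟩
  · have h1 := hx t ht
    rw [hGF _ (hxρ t ht)] at h1
    exact h1
  · have hyρ := barrier hn hNop F F d₁ R₂ (Nop q + B τtmin) hρ (hC1 q hqR) (hmuop q hqR)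
      (fun _ _ => rfl) q (d₂ * Nop q + ε) hc B hB0 τtmin hBd hBρ y hy0 hy
    have hy' : ∀ t ∈ Icc (0:ℝ) τtmin, HasDerivWithinAt y (G (y t)) (Icc 0 τtmin) t := by
      intro t ht
      rw [hGF _ (hyρ t ht)]
      exact hy t ht
    exact ODE_solution_unique_of_mem_Icc_right (v := fun _ => G) (s := fun _ => univ) (K := KG)
      (fun t _ => hGlip.lipschitzOnWith)
      (fun t ht => (hy' t ht).continuousWithinAt) (right y hy') (fun _ _ => mem_univ _)
      (fun t ht => (hx t ht).continuousWithinAt) (right x hx) (fun _ _ => mem_univ _)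
      (hy0.trans hx0'.symm)

end
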